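/- arXiv:2108.13758 — 2 statements merged into one kernel-verified Lean document; each statement's English description precedes it below -/
import Mathlib

section
/- Let 0 < p < 1 and q > p. Then for every x ≤ 0: (i) 0 ≤ E_p(x) ≤ 1, and (ii) 0 ≤ E_{p,q}(x) ≤ 1/Γ(q). -/
open Real

/-- Two-parameter Mittag-Leffler function `E_{p,q}(x) = ∑_{k=0}^∞ x^k / Γ(pk+q)`;
the one-parameter function is `E_p = E_{p,1}`. -/
noncomputable def mittagLeffler (p q x : ℝ) : ℝ :=
  ∑' k : ℕ, x ^ k / Real.Gamma (p * k + q)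

open MeasureTheory Set Filter Topology

theorem Real.rpow_mul_exp_neg_le_Gamma {a R : ℝ} (ha : 1 ≤ a) (hR : 0 < R) :
    R ^ (a - 1) * exp (-R) ≤ Gamma a := by
  have ha0 : 0 < a := by linarith
  have hint := Real.GammaIntegral_convergent ha0
  have hsub : Ioi R ⊆ Ioi (0 : ℝ) := Ioi_subset_Ioi hR.le
  calc R ^ (a - 1) * exp (-R) = ∫ x in Ioi R, R ^ (a - 1) * exp (-x) := by
        rw [integral_const_mul, integral_exp_neg_Ioi]
    _ ≤ ∫ x in Ioi R, exp (-x) * x ^ (a - 1) := by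
        refine setIntegral_mono_on ((integrableOn_exp_neg_Ioi R).const_mul _)
          (hint.mono_set hsub) measurableSet_Ioi fun x hx => ?_
        rw [mul_comm]
        gcongr
        exact le_of_lt hx
    _ ≤ ∫ x in Ioi 0, exp (-x) * x ^ (a - 1) := by
        refine setIntegral_mono_set hint ?_ hsub.eventuallyLE
        filter_upwards [self_mem_ae_restrict measurableSet_Ioi] with x hx
        have : (0 : ℝ) < x := hx
        simp only [Pi.zero_apply]
        positivity
    _ = Gamma a := (Real.Gamma_eq_integral ha0).symm

theorem summable_pow_div_Gamma {p q y : ℝ} (hp : 0 < p) (hq : 0 < q) (hy : 0 ≤ y) :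
    Summable fun k : ℕ => y ^ k / Gamma (p * k + q) := by
  set R : ℝ := (2 * y + 1) ^ (1 / p)
  have hb : 0 < 2 * y + 1 := by positivity
  have hR : 0 < R := rpow_pos_of_pos hb _
  have hRp : R ^ p = 2 * y + 1 := by
    rw [← rpow_mul hb.le, one_div_mul_cancel hp.ne', rpow_one]
  have hlarge : ∀ᶠ k : ℕ in atTop, 1 ≤ p * k + q := by
    filter_upwards [(tendsto_natCast_atTop_atTop (R := ℝ)).eventually_ge_atTop (1 / p)] with k hk
    have : 1 ≤ p * k := by
      rw [div_le_iff₀ hp] at hk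
      linarith
    linarith
  have hgeom : Summable fun k : ℕ => (R ^ (q - 1) * exp (-R))⁻¹ * (1 / 2 : ℝ) ^ k :=
    (summable_geometric_of_lt_one (by norm_num) (by norm_num)).mul_left _
  refine hgeom.of_norm_bounded_eventually_nat ?_
  filter_upwards [hlarge] with k hk
  have hG : 0 < Gamma (p * k + q) := Gamma_pos_of_pos (by positivity)
  rw [norm_of_nonneg (by positivity), div_le_iff₀ hG]
  have hle := Real.rpow_mul_exp_neg_le_Gamma hk hR
  have hsplit : R ^ (p * k + q - 1) = (2 * y + 1) ^ k * R ^ (q - 1) := by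
    rw [add_sub_assoc, rpow_add hR, rpow_mul hR.le, hRp, rpow_natCast]
  have hpow : y ^ k ≤ (1 / 2 : ℝ) ^ k * (2 * y + 1) ^ k := by
    rw [← mul_pow]
    gcongr
    linarith
  have hc : 0 < R ^ (q - 1) * exp (-R) := by positivity
  calc y ^ k ≤ (1 / 2 : ℝ) ^ k * (2 * y + 1) ^ k := hpow
    _ = (R ^ (q - 1) * exp (-R))⁻¹ * (1 / 2 : ℝ) ^ k * (R ^ (p * k + q - 1) * exp (-R)) := by
        rw [hsplit]
        field_simp
    _ ≤ _ := by gcongr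

theorem norm_pow_div_Gamma {p q : ℝ} (hp : 0 < p) (hq : 0 < q) (x : ℝ) (k : ℕ) :
    ‖x ^ k / Gamma (p * k + q)‖ = |x| ^ k / Gamma (p * k + q) := by
  rw [norm_div, norm_pow, norm_eq_abs,
    norm_of_nonneg (Gamma_pos_of_pos (by positivity)).le]

theorem summable_mittagLeffler {p q : ℝ} (hp : 0 < p) (hq : 0 < q) (x : ℝ) :
    Summable fun k : ℕ => x ^ k / Gamma (p * k + q) :=
  (summable_pow_div_Gamma hp hq (abs_nonneg x)).of_norm_bounded
    fun k => (norm_pow_div_Gamma hp hq x k).le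

theorem continuous_mittagLeffler {p q : ℝ} (hp : 0 < p) (hq : 0 < q) :
    Continuous (mittagLeffler p q) := by
  refine continuous_iff_continuousAt.mpr fun x => ?_
  have hcont : ContinuousOn (mittagLeffler p q) (Metric.closedBall 0 (|x| + 1)) := by
    refine continuousOn_tsum (fun k => by fun_prop)
      (summable_pow_div_Gamma hp hq (y := |x| + 1) (by positivity)) fun k z hz => ?_
    rw [norm_pow_div_Gamma hp hq]
    have hG : 0 < Gamma (p * k + q) := Gamma_pos_of_pos (by positivity)
    have : |z| ≤ |x| + 1 := by simpa using hz
    gcongr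
  exact hcont.continuousAt (Metric.closedBall_mem_nhds_of_mem (by simp))

theorem mittagLeffler_eq_add_mul {p q : ℝ} (hp : 0 < p) (hq : 0 < q) (x : ℝ) :
    mittagLeffler p q x = 1 / Gamma q + x * mittagLeffler p (p + q) x := by
  unfold mittagLeffler
  rw [(summable_mittagLeffler hp hq x).tsum_eq_zero_add, ← tsum_mul_left]
  congr 1
  · simp
  · refine tsum_congr fun k => ?_
    push_cast
    rw [pow_succ', mul_div_assoc, mul_add_one, add_assoc]

theorem integral_rpow_mul_sub_rpow {a b t : ℝ} (ha : 0 < a) (hb : 0 < b) (ht : 0 < t) :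
    ∫ s in 0..t, s ^ (a - 1) * (t - s) ^ (b - 1) =
      t ^ (a + b - 1) * (Gamma a * Gamma b / Gamma (a + b)) := by
  have h := Complex.betaIntegral_scaled a b ht
  rw [Complex.betaIntegral_eq_Gamma_mul_div _ _ (by simpa) (by simpa)] at h
  have hL : ∫ s in 0..t, (s : ℂ) ^ ((a : ℂ) - 1) * ((t : ℂ) - s) ^ ((b : ℂ) - 1) =
      ∫ s in 0..t, ((s ^ (a - 1) * (t - s) ^ (b - 1) : ℝ) : ℂ) := by
    refine intervalIntegral.integral_congr fun s hs => ?_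
    rw [uIcc_of_le ht.le] at hs
    rw [Complex.ofReal_mul, Complex.ofReal_cpow hs.1, Complex.ofReal_cpow (sub_nonneg.mpr hs.2)]
    push_cast
    rfl
  rw [hL, intervalIntegral.integral_ofReal, ← Complex.ofReal_add, ← Complex.ofReal_one,
    ← Complex.ofReal_sub, ← Complex.ofReal_cpow ht.le, Complex.Gamma_ofReal, Complex.Gamma_ofReal,
    Complex.Gamma_ofReal] at h
  exact_mod_cast h

theorem intervalIntegrable_rpow_mul_sub_rpow {a b t : ℝ} (ha : 0 < a) (hb : 0 < b) (ht : 0 < t) :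
    IntervalIntegrable (fun s => s ^ (a - 1) * (t - s) ^ (b - 1)) volume 0 t := by
  refine intervalIntegral.intervalIntegrable_of_integral_ne_zero ?_
  rw [integral_rpow_mul_sub_rpow ha hb ht]
  have := Gamma_pos_of_pos ha
  have := Gamma_pos_of_pos hb
  have := Gamma_pos_of_pos (add_pos ha hb)
  positivity

theorem continuous_mittagLeffler_neg_rpow {p q : ℝ} (hp : 0 < p) (hq : 0 < q) :
    Continuous fun s : ℝ => mittagLeffler p q (-s ^ p) :=
  (continuous_mittagLeffler hp hq).comp (continuous_id.rpow_const fun _ => .inr hp.le).neg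

/-- The Riemann–Liouville fractional integral of order `p` of `s ^ (q - 1) * E_{p,q}(-s ^ p)`. -/
theorem integral_sub_rpow_mul_mittagLeffler {p q t : ℝ} (hp : 0 < p) (hq : 0 < q) (ht : 0 < t) :
    ∫ s in 0..t, (t - s) ^ (p - 1) * (s ^ (q - 1) * mittagLeffler p q (-s ^ p)) =
      Gamma p * (t ^ (p + q - 1) * mittagLeffler p (p + q) (-t ^ p)) := by
  set F : ℕ → ℝ → ℝ := fun k s =>
    (-1) ^ k / Gamma (p * k + q) * (s ^ (p * k + q - 1) * (t - s) ^ (p - 1))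
  have hkq (k : ℕ) : 0 < p * k + q := by positivity
  have hG (k : ℕ) : 0 < Gamma (p * k + q) := Gamma_pos_of_pos (hkq k)
  have hFint (k : ℕ) : IntegrableOn (F k) (Ioc 0 t) :=
    (intervalIntegrable_iff_integrableOn_Ioc_of_le ht.le).mp
      ((intervalIntegrable_rpow_mul_sub_rpow (hkq k) hp ht).const_mul _)
  have hpow (k : ℕ) :
      t ^ (p * k + q + p - 1) = t ^ (p + q - 1) * (t ^ p) ^ k := by
    rw [← rpow_mul_natCast ht.le, ← rpow_add ht]
    ring_nf
  have hFval (k : ℕ) : ∫ s in Ioc 0 t, F k s =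
      Gamma p * t ^ (p + q - 1) * ((-t ^ p) ^ k / Gamma (p * k + (p + q))) := by
    rw [← intervalIntegral.integral_of_le ht.le, intervalIntegral.integral_const_mul,
      integral_rpow_mul_sub_rpow (hkq k) hp ht, hpow, neg_pow (t ^ p),
      show p * k + (p + q) = p * k + q + p by ring]
    have := (hG k).ne'
    field_simp
  have hFnorm (k : ℕ) : ∫ s in Ioc 0 t, ‖F k s‖ =
      Gamma p * t ^ (p + q - 1) * ((t ^ p) ^ k / Gamma (p * k + (p + q))) := by
    have hcongr : ∫ s in Ioc 0 t, ‖F k s‖ = ∫ s in Ioc 0 t,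
        1 / Gamma (p * k + q) * (s ^ (p * k + q - 1) * (t - s) ^ (p - 1)) := by
      refine setIntegral_congr_fun measurableSet_Ioc fun s hs => ?_
      have h1 : 0 ≤ s ^ (p * k + q - 1) := rpow_nonneg hs.1.le _
      have h2 : 0 ≤ (t - s) ^ (p - 1) := rpow_nonneg (sub_nonneg.mpr hs.2) _
      simp only [F]
      rw [norm_mul, norm_div, norm_of_nonneg (hG k).le, norm_of_nonneg (mul_nonneg h1 h2)]
      simp
    rw [hcongr, ← intervalIntegral.integral_of_le ht.le, intervalIntegral.integral_const_mul,
      integral_rpow_mul_sub_rpow (hkq k) hp ht, hpow,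
      show p * k + (p + q) = p * k + q + p by ring]
    have := (hG k).ne'
    field_simp
  have hsum : Summable fun k => ∫ s in Ioc 0 t, ‖F k s‖ := by
    simp_rw [hFnorm]
    exact (summable_mittagLeffler hp (add_pos hp hq) _).mul_left _
  have key := (hasSum_integral_of_summable_integral_norm hFint hsum).tsum_eq
  simp_rw [hFval] at key
  rw [tsum_mul_left] at key
  rw [intervalIntegral.integral_of_le ht.le, ← mul_assoc]
  refine Eq.trans ?_ key.symm
  refine setIntegral_congr_fun measurableSet_Ioc fun s hs => ?_
  simp only [F, mittagLeffler]
  rw [← tsum_mul_left, ← tsum_mul_left]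
  refine tsum_congr fun k => ?_
  rw [neg_pow (s ^ p), show p * k + q - 1 = q - 1 + p * k by ring, rpow_add hs.1,
    rpow_mul_natCast hs.1.le]
  ring

theorem intervalIntegrable_sub_rpow_mul_mittagLeffler {p q t : ℝ}
    (hp : 0 < p) (hq : 0 < q) (ht : 0 < t) :
    IntervalIntegrable (fun s => (t - s) ^ (p - 1) * (s ^ (q - 1) * mittagLeffler p q (-s ^ p)))
      volume 0 t := by
  refine ((intervalIntegrable_rpow_mul_sub_rpow hq hp ht).mul_continuousOn
    (continuous_mittagLeffler_neg_rpow hp hq).continuousOn).congr fun s _ => ?_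
  ring

theorem volterra_mittagLeffler {p q t : ℝ} (hp : 0 < p) (hq : 0 < q) (ht : 0 < t) :
    Gamma p * (t ^ (q - 1) * mittagLeffler p q (-t ^ p)) = Gamma p / Gamma q * t ^ (q - 1) -
      ∫ s in 0..t, (t - s) ^ (p - 1) * (s ^ (q - 1) * mittagLeffler p q (-s ^ p)) := by
  rw [integral_sub_rpow_mul_mittagLeffler hp hq ht, mittagLeffler_eq_add_mul hp hq,
    add_sub_assoc p, rpow_add ht]
  ring

/-- Comparison of the Volterra equation at `t` and at a later point where the solution is
nonpositive. -/
theorem mittagLeffler_le_integral {p q t t₀ : ℝ} (hp : 0 < p) (hp1 : p < 1) (hpq : p ≤ q)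
    (ht : 0 < t) (htt : t < t₀) (hneg : mittagLeffler p q (-t₀ ^ p) ≤ 0)
    (hpos : ∀ s ∈ Ioo 0 t₀, 0 ≤ mittagLeffler p q (-s ^ p)) :
    Gamma p * (t ^ (q - 1) * mittagLeffler p q (-t ^ p)) ≤ (t / t₀) ^ (p - 1) *
      ∫ s in t..t₀, (t₀ - s) ^ (p - 1) * (s ^ (q - 1) * mittagLeffler p q (-s ^ p)) := by
  have hq : 0 < q := hp.trans_le hpq
  have ht₀ : 0 < t₀ := ht.trans htt
  have hi := intervalIntegrable_sub_rpow_mul_mittagLeffler hp hq ht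
  have hi₀ := intervalIntegrable_sub_rpow_mul_mittagLeffler hp hq ht₀
  have hv := volterra_mittagLeffler hp hq ht
  have hv₀ := volterra_mittagLeffler hp hq ht₀
  set f : ℝ → ℝ := fun s => s ^ (q - 1) * mittagLeffler p q (-s ^ p)
  have hf₀ : f t₀ ≤ 0 := mul_nonpos_of_nonneg_of_nonpos (by positivity) hneg
  have hΓp := Gamma_pos_of_pos hp
  have hΓq := Gamma_pos_of_pos hq
  have hia : IntervalIntegrable (fun s => (t₀ - s) ^ (p - 1) * f s) volume 0 t :=
    hi₀.mono_set (by rw [uIcc_of_le ht.le, uIcc_of_le ht₀.le]; exact Icc_subset_Icc_right htt.le)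
  have hib : IntervalIntegrable (fun s => (t₀ - s) ^ (p - 1) * f s) volume t t₀ :=
    hi₀.mono_set (by rw [uIcc_of_le htt.le, uIcc_of_le ht₀.le]; exact Icc_subset_Icc_left ht.le)
  have hsplit := intervalIntegral.integral_add_adjacent_intervals hia hib
  have hcmp : (t / t₀) ^ (p - 1) * ∫ s in 0..t, (t₀ - s) ^ (p - 1) * f s ≤
      ∫ s in 0..t, (t - s) ^ (p - 1) * f s := by
    rw [← intervalIntegral.integral_const_mul]
    refine intervalIntegral.integral_mono_on_of_le_Ioo ht.le (hia.const_mul _) hi fun s hs => ?_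
    have hs₀ : 0 < t₀ - s := by linarith [hs.2]
    have hst : 0 < t - s := by linarith [hs.2]
    have hfs : 0 ≤ f s :=
      mul_nonneg (rpow_nonneg hs.1.le _) (hpos s ⟨hs.1, hs.2.trans htt⟩)
    rw [← mul_assoc, ← mul_rpow (by positivity) hs₀.le]
    refine mul_le_mul_of_nonneg_right ?_ hfs
    refine rpow_le_rpow_of_nonpos hst ?_ (by linarith)
    rw [div_mul_eq_mul_div, le_div_iff₀ ht₀]
    nlinarith [mul_pos hs.1 (sub_pos.mpr htt)]
  have hpw : t ^ (q - 1) ≤ (t / t₀) ^ (p - 1) * t₀ ^ (q - 1) := by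
    have e : t ^ (q - 1) = t ^ (p - 1) * t ^ (q - p) := by rw [← rpow_add ht]; ring_nf
    have e₀ : t₀ ^ (q - 1) = t₀ ^ (p - 1) * t₀ ^ (q - p) := by rw [← rpow_add ht₀]; ring_nf
    rw [e, e₀, ← mul_assoc, ← mul_rpow (by positivity) ht₀.le, div_mul_cancel₀ _ ht₀.ne']
    have : 0 ≤ q - p := sub_nonneg.mpr hpq
    gcongr
  have hr : 0 < (t / t₀) ^ (p - 1) := by positivity
  have hle₀ : Gamma p / Gamma q * t₀ ^ (q - 1) ≤ ∫ s in 0..t₀, (t₀ - s) ^ (p - 1) * f s := by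
    have : Gamma p * f t₀ ≤ 0 := mul_nonpos_of_nonneg_of_nonpos hΓp.le hf₀
    simp only [f] at this ⊢
    linarith
  have h1 := mul_le_mul_of_nonneg_left hpw (div_pos hΓp hΓq).le
  have h2 := mul_le_mul_of_nonneg_left hle₀ hr.le
  rw [← hsplit, mul_add] at h2
  linarith

theorem mittagLeffler_neg_rpow_pos {p q : ℝ} (hp : 0 < p) (hp1 : p < 1) (hpq : p ≤ q)
    {t : ℝ} (ht : 0 ≤ t) : 0 < mittagLeffler p q (-t ^ p) := by
  by_contra! hcon
  have hq : 0 < q := hp.trans_le hpq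
  have hcont := continuous_mittagLeffler_neg_rpow hp hq
  set Z : Set ℝ := {s | 0 ≤ s ∧ mittagLeffler p q (-s ^ p) ≤ 0}
  have hZbdd : BddBelow Z := ⟨0, fun s hs => hs.1⟩
  have hZmem : sInf Z ∈ Z :=
    ((isClosed_le continuous_const continuous_id).inter
      (isClosed_le hcont continuous_const)).csInf_mem ⟨t, ht, hcon⟩ hZbdd
  set t₀ := sInf Z
  have hpos : ∀ s, 0 ≤ s → s < t₀ → 0 < mittagLeffler p q (-s ^ p) := fun s hs hst => by
    by_contra! h
    exact (csInf_le hZbdd ⟨hs, h⟩).not_gt hst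
  have ht₀ : 0 < t₀ := by
    refine hZmem.1.lt_of_ne' fun h => hZmem.2.not_gt ?_
    rw [h, zero_rpow hp.ne', neg_zero, mittagLeffler_eq_add_mul hp hq]
    simpa using Gamma_pos_of_pos hq
  have hΓp := Gamma_pos_of_pos hp
  -- The kernel has small mass close to `t₀`.
  obtain ⟨t₁, ht₁, ht₁₀, hsmall⟩ : ∃ t₁, t₀ / 2 < t₁ ∧ t₁ < t₀ ∧
      (1 / 2 : ℝ) ^ (p - 1) * ((t₀ - t₁) ^ p / p) < Gamma p := by
    have hlim : Tendsto (fun s => (1 / 2 : ℝ) ^ (p - 1) * ((t₀ - s) ^ p / p)) (𝓝[<] t₀)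
        (𝓝 ((1 / 2 : ℝ) ^ (p - 1) * ((t₀ - t₀) ^ p / p))) := by
      refine Tendsto.mono_left ?_ nhdsWithin_le_nhds
      have : Continuous fun s : ℝ => (1 / 2 : ℝ) ^ (p - 1) * ((t₀ - s) ^ p / p) :=
        (((continuous_const.sub continuous_id).rpow_const fun _ => .inr hp.le).div_const _).const_mul _
      exact this.tendsto t₀
    rw [sub_self, zero_rpow hp.ne', zero_div, mul_zero] at hlim
    have hev : ∀ᶠ s in 𝓝[<] t₀, t₀ / 2 < s :=
      nhdsWithin_le_nhds (lt_mem_nhds (half_lt_self ht₀))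
    obtain ⟨s, h1, h2, h3⟩ :=
      ((hlim.eventually_lt_const hΓp).and (hev.and self_mem_nhdsWithin)).exists
    exact ⟨s, h2, h3, h1⟩
  have ht₁pos : 0 < t₁ := by linarith
  obtain ⟨m, hm, hmax⟩ := isCompact_Icc.exists_isMaxOn (nonempty_Icc.mpr ht₁₀.le)
    (f := fun s => s ^ (q - 1) * mittagLeffler p q (-s ^ p))
    (ContinuousOn.mul (continuousOn_id.rpow_const fun s hs => .inl (ht₁pos.trans_le hs.1).ne')
      hcont.continuousOn)
  have hmpos : 0 < m := ht₁pos.trans_le hm.1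
  have hMpos : 0 < m ^ (q - 1) * mittagLeffler p q (-m ^ p) :=
    (mul_pos (rpow_pos_of_pos ht₁pos _) (hpos t₁ ht₁pos.le ht₁₀)).trans_le
      (hmax (left_mem_Icc.mpr ht₁₀.le))
  have hmt₀ : m < t₀ := by
    refine hm.2.lt_of_ne fun h => hMpos.not_ge ?_
    rw [h]
    exact mul_nonpos_of_nonneg_of_nonpos (by positivity) hZmem.2
  have hcmp := mittagLeffler_le_integral hp hp1 hpq hmpos hmt₀ hZmem.2
    fun s hs => (hpos s hs.1.le hs.2).le
  set M := m ^ (q - 1) * mittagLeffler p q (-m ^ p)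
  have hker : IntervalIntegrable (fun s => (t₀ - s) ^ (p - 1)) volume m t₀ := by
    have := (intervalIntegral.intervalIntegrable_rpow' (a := t₀ - m) (b := 0)
      (show -1 < p - 1 by linarith)).comp_sub_left t₀
    simpa using this
  have hkerval : ∫ s in m..t₀, (t₀ - s) ^ (p - 1) = (t₀ - m) ^ p / p := by
    rw [intervalIntegral.integral_comp_sub_left (fun s => s ^ (p - 1)) t₀,
      integral_rpow (.inl (by linarith))]
    simp [zero_rpow hp.ne']
  have hint : ∫ s in m..t₀, (t₀ - s) ^ (p - 1) * (s ^ (q - 1) * mittagLeffler p q (-s ^ p)) ≤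
      (t₀ - m) ^ p / p * M := by
    rw [← hkerval, ← intervalIntegral.integral_mul_const]
    refine intervalIntegral.integral_mono_on hmt₀.le
      ((intervalIntegrable_sub_rpow_mul_mittagLeffler hp hq ht₀).mono_set ?_)
      (hker.mul_const _) fun s hs => ?_
    · rw [uIcc_of_le hmt₀.le, uIcc_of_le ht₀.le]
      exact Icc_subset_Icc_left hmpos.le
    · exact mul_le_mul_of_nonneg_left (hmax ⟨hm.1.trans hs.1, hs.2⟩)
        (rpow_nonneg (sub_nonneg.mpr hs.2) _)
  have hratio : (m / t₀) ^ (p - 1) ≤ (1 / 2 : ℝ) ^ (p - 1) := by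
    refine rpow_le_rpow_of_nonpos (by norm_num) ?_ (by linarith)
    rw [le_div_iff₀ ht₀]
    linarith [hm.1]
  have hlen : (t₀ - m) ^ p ≤ (t₀ - t₁) ^ p :=
    rpow_le_rpow (by linarith) (by linarith [hm.1]) hp.le
  have hfinal : Gamma p * M ≤ (1 / 2 : ℝ) ^ (p - 1) * ((t₀ - t₁) ^ p / p) * M :=
    calc Gamma p * M ≤ (m / t₀) ^ (p - 1) * ((t₀ - m) ^ p / p * M) :=
          hcmp.trans (mul_le_mul_of_nonneg_left hint (by positivity))
      _ ≤ (1 / 2 : ℝ) ^ (p - 1) * ((t₀ - t₁) ^ p / p * M) := by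
          have : 0 ≤ (t₀ - m) ^ p := rpow_nonneg (by linarith) _
          gcongr
      _ = _ := by ring
  exact (le_of_mul_le_mul_right hfinal hMpos).not_gt hsmall

theorem mittagLeffler_pos_of_nonpos {p q x : ℝ} (hp : 0 < p) (hp1 : p < 1) (hpq : p ≤ q)
    (hx : x ≤ 0) : 0 < mittagLeffler p q x := by
  have hx' : 0 ≤ -x := neg_nonneg.mpr hx
  have h := mittagLeffler_neg_rpow_pos hp hp1 hpq (rpow_nonneg hx' (1 / p))
  rwa [← rpow_mul hx', one_div_mul_cancel hp.ne', rpow_one, neg_neg] at h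

theorem mittagLeffler_le_one_div_Gamma {p q x : ℝ} (hp : 0 < p) (hp1 : p < 1) (hq : 0 < q)
    (hx : x ≤ 0) : mittagLeffler p q x ≤ 1 / Gamma q := by
  rw [mittagLeffler_eq_add_mul hp hq]
  have h := mittagLeffler_pos_of_nonpos hp hp1 (show p ≤ p + q by linarith) hx
  linarith [mul_nonpos_of_nonpos_of_nonneg hx h.le]

/-- For `0 < p < 1`, `q > p` and every `x ≤ 0`:
(i) `0 ≤ E_p(x) ≤ 1` and (ii) `0 ≤ E_{p,q}(x) ≤ 1/Γ(q)`. -/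
theorem mittagLeffler_nonneg_bounds (p q : ℝ) (hp0 : 0 < p) (hp1 : p < 1)
    (hpq : p < q) (x : ℝ) (hx : x ≤ 0) :
    (0 ≤ mittagLeffler p 1 x ∧ mittagLeffler p 1 x ≤ 1) ∧
      (0 ≤ mittagLeffler p q x ∧ mittagLeffler p q x ≤ 1 / Real.Gamma q) := by
  have hp1' := mittagLeffler_le_one_div_Gamma hp0 hp1 one_pos hx
  rw [Gamma_one, div_one] at hp1'
  exact ⟨⟨(mittagLeffler_pos_of_nonpos hp0 hp1 hp1.le hx).le, hp1'⟩,
    (mittagLeffler_pos_of_nonpos hp0 hp1 hpq.le hx).le,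
    mittagLeffler_le_one_div_Gamma hp0 hp1 (hp0.trans hpq) hx⟩
end

section
/- Let 0 < μ < 1 and let z : [a,∞) → ℝ be continuously differentiable such that both z and z' are of Φ-exponential order with constant c, i.e. |z(ℓ)| ≤ M e^{c(Φ(ℓ)−Φ(a))} and |z'(ℓ)| ≤ M' e^{c(Φ(ℓ)−Φ(a))} Φ'(ℓ) for all ℓ ≥ a. Then for every λ > max(c, 0), the generalized Laplace transform of the Φ-Caputo fractional derivative of z satisfies L_Φ{ᶜD^{μ;Φ}z}(λ) = λ^μ L_Φ{z}(λ) − λ^{μ−1} z(a). -/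
open Real MeasureTheory Set Filter

section ChangeOfVariables

variable {b : ℝ} {Φ Φ' : ℝ → ℝ}

lemma strictMonoOn_Ici_of_hasDerivAt_pos (hd : ∀ x ∈ Ici b, HasDerivAt Φ (Φ' x) x)
    (hpos : ∀ x ∈ Ici b, 0 < Φ' x) : StrictMonoOn Φ (Ici b) :=
  strictMonoOn_of_hasDerivWithinAt_pos (convex_Ici b)
    (fun x hx => (hd x hx).continuousAt.continuousWithinAt)
    (fun x hx => (hd x (interior_subset hx)).hasDerivWithinAt)
    (fun x hx => hpos x (interior_subset hx))

lemma image_sub_Ioi_of_hasDerivAt_pos (hd : ∀ x ∈ Ici b, HasDerivAt Φ (Φ' x) x)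
    (hpos : ∀ x ∈ Ici b, 0 < Φ' x) (htop : Tendsto Φ atTop atTop) :
    (fun x => Φ x - Φ b) '' Ioi b = Ioi 0 := by
  have hmono := strictMonoOn_Ici_of_hasDerivAt_pos hd hpos
  ext t
  constructor
  · rintro ⟨x, hx, rfl⟩
    exact sub_pos.2 (hmono self_mem_Ici (Ioi_subset_Ici_self hx) hx)
  · intro ht
    obtain ⟨x, hx, hxt⟩ := isPreconnected_Ici.intermediate_value_Ici (self_mem_Ici (a := b))
      (l := atTop) (le_principal_iff.2 (Ici_mem_atTop b))
      (fun x hx => (hd x hx).continuousAt.continuousWithinAt) htop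
      (mem_Ici.2 (le_add_of_nonneg_left (le_of_lt (mem_Ioi.1 ht))))
    refine ⟨x, mem_Ioi.2 (lt_of_le_of_ne hx ?_), by simp [hxt]⟩
    rintro rfl
    have : (0 : ℝ) < t := ht
    linarith

lemma integral_Ioi_comp_sub_mul_deriv (hd : ∀ x ∈ Ici b, HasDerivAt Φ (Φ' x) x)
    (hpos : ∀ x ∈ Ici b, 0 < Φ' x) (htop : Tendsto Φ atTop atTop) (g : ℝ → ℝ) :
    ∫ x in Ioi b, g (Φ x - Φ b) * Φ' x = ∫ t in Ioi 0, g t := by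
  have hmono := strictMonoOn_Ici_of_hasDerivAt_pos hd hpos
  rw [← image_sub_Ioi_of_hasDerivAt_pos hd hpos htop,
    integral_image_eq_integral_abs_deriv_smul (f' := Φ') measurableSet_Ioi
      (fun x hx => ((hd x (Ioi_subset_Ici_self hx)).sub_const _).hasDerivWithinAt)
      (fun x hx y hy h => hmono.injOn (Ioi_subset_Ici_self hx) (Ioi_subset_Ici_self hy)
        (sub_left_injective h))]
  refine setIntegral_congr_fun measurableSet_Ioi fun x hx => ?_
  simp [abs_of_pos (hpos x (Ioi_subset_Ici_self hx)), mul_comm]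

lemma integrableOn_Ioi_comp_sub_mul_deriv (hd : ∀ x ∈ Ici b, HasDerivAt Φ (Φ' x) x)
    (hpos : ∀ x ∈ Ici b, 0 < Φ' x) (htop : Tendsto Φ atTop atTop) {g : ℝ → ℝ}
    (hg : IntegrableOn g (Ioi 0)) :
    IntegrableOn (fun x => g (Φ x - Φ b) * Φ' x) (Ioi b) := by
  have hmono := strictMonoOn_Ici_of_hasDerivAt_pos hd hpos
  rw [← image_sub_Ioi_of_hasDerivAt_pos hd hpos htop,
    integrableOn_image_iff_integrableOn_abs_deriv_smul (f' := Φ') measurableSet_Ioi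
      (fun x hx => ((hd x (Ioi_subset_Ici_self hx)).sub_const _).hasDerivWithinAt)
      (fun x hx y hy h => hmono.injOn (Ioi_subset_Ici_self hx) (Ioi_subset_Ici_self hy)
        (sub_left_injective h))] at hg
  refine hg.congr_fun (fun x hx => ?_) measurableSet_Ioi
  simp [abs_of_pos (hpos x (Ioi_subset_Ici_self hx)), mul_comm]

end ChangeOfVariables

lemma integrableOn_rpow_neg_mul_exp {μ lam : ℝ} (hμ : μ < 1) (hlam : 0 < lam) :
    IntegrableOn (fun t : ℝ => t ^ (-μ) * Real.exp (-lam * t)) (Ioi 0) := by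
  simpa using integrableOn_rpow_mul_exp_neg_mul_rpow (p := 1) (s := -μ) (by linarith) one_pos hlam

lemma integral_rpow_neg_mul_exp {μ lam : ℝ} (hμ : μ < 1) (hlam : 0 < lam) :
    ∫ t in Ioi (0 : ℝ), t ^ (-μ) * Real.exp (-lam * t) = lam ^ (μ - 1) * Real.Gamma (1 - μ) := by
  have h := Real.integral_rpow_mul_exp_neg_mul_Ioi (a := 1 - μ) (r := lam) (by linarith) hlam
  rw [one_div, Real.inv_rpow hlam.le, ← Real.rpow_neg hlam.le] at h
  simpa [show 1 - μ - 1 = -μ by ring] using h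

/-- Exchanging the order of integration over the triangle `a < ρ < ℓ` turns the weighted integral
of a `Φ`-convolution into a product. -/
lemma integral_Ioi_integral_Ioo_comp_sub {a : ℝ} {Φ Φ' : ℝ → ℝ}
    (hd : ∀ x ∈ Ici a, HasDerivAt Φ (Φ' x) x) (hc : ContinuousOn Φ' (Ici a))
    (hpos : ∀ x ∈ Ici a, 0 < Φ' x) (htop : Tendsto Φ atTop atTop)
    {h w : ℝ → ℝ} (hm : Measurable h) (hnonneg : ∀ t, 0 < t → 0 ≤ h t)
    (hh : IntegrableOn h (Ioi 0)) (hw : IntegrableOn w (Ioi a)) :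
    ∫ ℓ in Ioi a, ∫ ρ in Ioo a ℓ, w ρ * (h (Φ ℓ - Φ ρ) * Φ' ℓ)
      = (∫ t in Ioi 0, h t) * ∫ ρ in Ioi a, w ρ := by
  have hmono := strictMonoOn_Ici_of_hasDerivAt_pos hd hpos
  have hsub : ∀ {ρ}, ρ ∈ Ioi a → Ici ρ ⊆ Ici a := fun hρ => Ici_subset_Ici.2 (le_of_lt hρ)
  let K : ℝ → ℝ → ℝ := fun ℓ ρ =>
    {p : ℝ × ℝ | p.2 < p.1}.indicator (fun p => w p.2 * (h (Φ p.1 - Φ p.2) * Φ' p.1)) (ℓ, ρ)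
  have hK : ∀ ρ, (fun ℓ => K ℓ ρ) =
      (Ioi ρ).indicator (fun ℓ => w ρ * (h (Φ ℓ - Φ ρ) * Φ' ℓ)) := by
    intro ρ; ext ℓ; simp [K, indicator_apply]
  have hK' : ∀ ℓ, (fun ρ => K ℓ ρ) =
      (Iio ℓ).indicator (fun ρ => w ρ * (h (Φ ℓ - Φ ρ) * Φ' ℓ)) := by
    intro ℓ; ext ρ; simp [K, indicator_apply]
  have hinter : ∀ {ρ}, ρ ∈ Ioi a → Ioi a ∩ Ioi ρ = Ioi ρ := fun {ρ} hρ =>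
    inter_eq_right.2 (Ioi_subset_Ioi (le_of_lt hρ))
  have hmeas : AEStronglyMeasurable (Function.uncurry K)
      ((volume.restrict (Ioi a)).prod (volume.restrict (Ioi a))) := by
    have hΦm : AEMeasurable Φ (volume.restrict (Ioi a)) :=
      ContinuousOn.aemeasurable (fun x hx =>
        (hd x (Ioi_subset_Ici_self hx)).continuousAt.continuousWithinAt) measurableSet_Ioi
    have hΦ'm : AEMeasurable Φ' (volume.restrict (Ioi a)) :=
      (hc.mono Ioi_subset_Ici_self).aemeasurable measurableSet_Ioi
    have hwm : AEMeasurable w (volume.restrict (Ioi a)) := hw.aestronglyMeasurable.aemeasurable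
    have hset : MeasurableSet {p : ℝ × ℝ | p.2 < p.1} :=
      measurableSet_lt measurable_snd measurable_fst
    exact ((hwm.comp_snd.mul ((hm.comp_aemeasurable
      (hΦm.comp_fst.sub hΦm.comp_snd)).mul hΦ'm.comp_fst)).indicator hset).aestronglyMeasurable
  have hint : Integrable (Function.uncurry K)
      ((volume.restrict (Ioi a)).prod (volume.restrict (Ioi a))) := by
    rw [integrable_prod_iff' hmeas]
    constructor
    · filter_upwards [ae_restrict_mem measurableSet_Ioi] with ρ hρ
      simp only [Function.uncurry_apply_pair]
      rw [hK, integrable_indicator_iff measurableSet_Ioi, IntegrableOn,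
        Measure.restrict_restrict measurableSet_Ioi, inter_comm, hinter hρ]
      exact (integrableOn_Ioi_comp_sub_mul_deriv (fun x hx => hd x (hsub hρ hx))
        (fun x hx => hpos x (hsub hρ hx)) htop hh).const_mul _
    · refine (hw.norm.mul_const (∫ t in Ioi 0, h t)).congr ?_
      filter_upwards [ae_restrict_mem measurableSet_Ioi] with ρ hρ
      have hnorm : (fun ℓ => ‖Function.uncurry K (ℓ, ρ)‖) =
          (Ioi ρ).indicator (fun ℓ => ‖w ρ * (h (Φ ℓ - Φ ρ) * Φ' ℓ)‖) := by
        ext ℓ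
        rw [Function.uncurry_apply_pair, congrFun (hK ρ) ℓ, norm_indicator_eq_indicator_norm]
      rw [hnorm, setIntegral_indicator measurableSet_Ioi, hinter hρ,
        ← integral_Ioi_comp_sub_mul_deriv (fun x hx => hd x (hsub hρ hx))
        (fun x hx => hpos x (hsub hρ hx)) htop, ← integral_const_mul]
      refine setIntegral_congr_fun measurableSet_Ioi fun ℓ hℓ => ?_
      have h1 : 0 ≤ h (Φ ℓ - Φ ρ) := hnonneg _ (sub_pos.2 (hmono (Ioi_subset_Ici_self hρ)
        (hsub hρ (Ioi_subset_Ici_self hℓ)) hℓ))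
      have h2 := hpos ℓ (hsub hρ (Ioi_subset_Ici_self hℓ))
      simp [abs_of_nonneg h1, abs_of_pos h2]
  calc ∫ ℓ in Ioi a, ∫ ρ in Ioo a ℓ, w ρ * (h (Φ ℓ - Φ ρ) * Φ' ℓ)
      = ∫ ℓ in Ioi a, ∫ ρ in Ioi a, K ℓ ρ := by
        refine integral_congr_ae (Eventually.of_forall fun ℓ => ?_)
        simp only [hK', setIntegral_indicator measurableSet_Iio, Ioi_inter_Iio]
    _ = ∫ ρ in Ioi a, ∫ ℓ in Ioi a, K ℓ ρ := integral_integral_swap hint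
    _ = ∫ ρ in Ioi a, (∫ t in Ioi 0, h t) * w ρ := by
        refine setIntegral_congr_fun measurableSet_Ioi fun ρ hρ => ?_
        simp only [hK, setIntegral_indicator measurableSet_Ioi, hinter hρ]
        rw [integral_const_mul, integral_Ioi_comp_sub_mul_deriv (fun x hx => hd x (hsub hρ hx))
          (fun x hx => hpos x (hsub hρ hx)) htop, mul_comm]
    _ = _ := integral_const_mul _ _

/-- For `0 < μ < 1` and `z` continuously differentiable with `z` and `z'`
of Φ-exponential order with constant `c`, the generalized Laplace transform of the
Φ-Caputo fractional derivative of `z` satisfies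
`L_Φ{ᶜD^{μ;Φ}z}(λ) = λ^μ L_Φ{z}(λ) − λ^{μ−1} z(a)` for every `λ > max(c,0)`. -/
theorem generalized_laplace_of_caputo_deriv
    (a : ℝ) (Φ Φ' : ℝ → ℝ)
    (hΦd : ∀ x ∈ Ici a, HasDerivAt Φ (Φ' x) x)
    (hΦ'c : ContinuousOn Φ' (Ici a))
    (hΦ'pos : ∀ x ∈ Ici a, 0 < Φ' x)
    (hΦtop : Tendsto Φ atTop atTop)
    (μ : ℝ) (hμ0 : 0 < μ) (hμ1 : μ < 1)
    (z z' : ℝ → ℝ)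
    (hzd : ∀ x ∈ Ici a, HasDerivAt z (z' x) x)
    (hz'c : ContinuousOn z' (Ici a))
    (M M' c : ℝ) (hM : 0 ≤ M) (hM' : 0 ≤ M')
    (hbound : ∀ ℓ ∈ Ici a, |z ℓ| ≤ M * Real.exp (c * (Φ ℓ - Φ a)))
    (hbound' : ∀ ℓ ∈ Ici a, |z' ℓ| ≤ M' * Real.exp (c * (Φ ℓ - Φ a)) * Φ' ℓ)
    (lam : ℝ) (hlam : max c 0 < lam) :
    (∫ ℓ in Ioi a,
        Real.exp (-lam * (Φ ℓ - Φ a)) *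
          ((1 / Real.Gamma (1 - μ)) * ∫ ρ in a..ℓ, (Φ ℓ - Φ ρ) ^ (-μ) * z' ρ) *
          Φ' ℓ)
      = lam ^ μ * (∫ ℓ in Ioi a, Real.exp (-lam * (Φ ℓ - Φ a)) * z ℓ * Φ' ℓ)
        - lam ^ (μ - 1) * z a := by
  obtain ⟨hcl, hl⟩ := max_lt_iff.1 hlam
  have hΦc : ContinuousOn Φ (Ici a) := fun x hx => (hΦd x hx).continuousAt.continuousWithinAt
  have hzc : ContinuousOn z (Ici a) := fun x hx => (hzd x hx).continuousAt.continuousWithinAt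
  have hEc : ContinuousOn (fun x => Real.exp (-lam * (Φ x - Φ a))) (Ici a) := by fun_prop
  have hdecay : IntegrableOn (fun x => Real.exp ((c - lam) * (Φ x - Φ a)) * Φ' x) (Ioi a) :=
    integrableOn_Ioi_comp_sub_mul_deriv hΦd hΦ'pos hΦtop
      (integrableOn_exp_mul_Ioi (sub_neg.2 hcl) 0)
  have hexp : ∀ x, Real.exp (-lam * (Φ x - Φ a)) * Real.exp (c * (Φ x - Φ a))
      = Real.exp ((c - lam) * (Φ x - Φ a)) := fun x => by
    rw [← Real.exp_add]; ring_nf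
  have hz'int : IntegrableOn (fun x => Real.exp (-lam * (Φ x - Φ a)) * z' x) (Ioi a) := by
    refine (hdecay.const_mul M').mono'
      (((hEc.mul hz'c).mono Ioi_subset_Ici_self).aestronglyMeasurable measurableSet_Ioi) ?_
    filter_upwards [ae_restrict_mem measurableSet_Ioi] with x hx
    rw [Real.norm_eq_abs, abs_mul, Real.abs_exp, ← hexp]
    calc _ ≤ Real.exp (-lam * (Φ x - Φ a)) * (M' * Real.exp (c * (Φ x - Φ a)) * Φ' x) := by
          gcongr; exact hbound' x (Ioi_subset_Ici_self hx)
      _ = _ := by ring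
  have hzint : IntegrableOn (fun x => Real.exp (-lam * (Φ x - Φ a)) * z x * Φ' x) (Ioi a) := by
    refine (hdecay.const_mul M).mono'
      ((((hEc.mul hzc).mul hΦ'c).mono Ioi_subset_Ici_self).aestronglyMeasurable
        measurableSet_Ioi) ?_
    filter_upwards [ae_restrict_mem measurableSet_Ioi] with x hx
    have hp := hΦ'pos x (Ioi_subset_Ici_self hx)
    rw [Real.norm_eq_abs, abs_mul, abs_mul, Real.abs_exp, ← hexp, abs_of_pos hp]
    calc _ ≤ Real.exp (-lam * (Φ x - Φ a)) * (M * Real.exp (c * (Φ x - Φ a))) * Φ' x := by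
          gcongr; exact hbound x (Ioi_subset_Ici_self hx)
      _ = _ := by ring
  have hlim : Tendsto (fun x => Real.exp (-lam * (Φ x - Φ a)) * z x) atTop (nhds 0) := by
    have h0 : Tendsto (fun x => M * Real.exp ((c - lam) * (Φ x - Φ a))) atTop (nhds 0) := by
      have := Real.tendsto_exp_atBot.comp ((tendsto_atTop_add_const_right _ (-Φ a)
        hΦtop).const_mul_atTop_of_neg (sub_neg.2 hcl))
      simpa [Function.comp_def, sub_eq_add_neg] using this.const_mul M
    refine squeeze_zero_norm' ?_ h0
    filter_upwards [Ici_mem_atTop a] with x hx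
    rw [Real.norm_eq_abs, abs_mul, Real.abs_exp, ← hexp]
    calc _ ≤ Real.exp (-lam * (Φ x - Φ a)) * (M * Real.exp (c * (Φ x - Φ a))) := by
          gcongr; exact hbound x hx
      _ = _ := by ring
  have hparts : ∫ x in Ioi a, Real.exp (-lam * (Φ x - Φ a)) * z' x
      = lam * (∫ x in Ioi a, Real.exp (-lam * (Φ x - Φ a)) * z x * Φ' x) - z a := by
    have h := integral_Ioi_of_hasDerivAt_of_tendsto'
      (f := fun x => Real.exp (-lam * (Φ x - Φ a)) * z x)
      (f' := fun x => Real.exp (-lam * (Φ x - Φ a)) * z' x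
        - lam * (Real.exp (-lam * (Φ x - Φ a)) * z x * Φ' x)) (a := a)
      (fun x hx => by
        have := ((((hΦd x hx).sub_const (Φ a)).const_mul (-lam)).exp).mul (hzd x hx)
        exact this.congr_deriv (by ring))
      (hz'int.sub (hzint.const_mul lam)) hlim
    rw [integral_sub hz'int (hzint.const_mul lam), integral_const_mul] at h
    simp at h
    simp only [neg_mul]
    linarith
  have hG : Real.Gamma (1 - μ) ≠ 0 := (Real.Gamma_pos_of_pos (by linarith)).ne'
  have hswap := integral_Ioi_integral_Ioo_comp_sub hΦd hΦ'c hΦ'pos hΦtop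
    (h := fun t => t ^ (-μ) * Real.exp (-lam * t)) (by fun_prop)
    (fun t ht => by positivity) (integrableOn_rpow_neg_mul_exp hμ1 hl) hz'int
  rw [integral_rpow_neg_mul_exp hμ1 hl, hparts] at hswap
  calc _ = ∫ ℓ in Ioi a, (1 / Real.Gamma (1 - μ)) * ∫ ρ in Ioo a ℓ,
          Real.exp (-lam * (Φ ρ - Φ a)) * z' ρ *
            ((Φ ℓ - Φ ρ) ^ (-μ) * Real.exp (-lam * (Φ ℓ - Φ ρ)) * Φ' ℓ) := by
        refine setIntegral_congr_fun measurableSet_Ioi fun ℓ hℓ => ?_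
        rw [intervalIntegral.integral_of_le (le_of_lt hℓ), integral_Ioc_eq_integral_Ioo,
          show ∀ A B C D : ℝ, A * (B * C) * D = B * (A * D * C) by intros; ring,
          ← integral_const_mul]
        congr 2
        ext ρ
        rw [show -lam * (Φ ℓ - Φ a) = -lam * (Φ ρ - Φ a) + -lam * (Φ ℓ - Φ ρ) by ring,
          Real.exp_add]
        ring
    _ = _ := by
        rw [integral_const_mul, hswap, Real.rpow_sub_one hl.ne']
        field_simp
end
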